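/- Let B be an even simple Bratteli diagram with full group G=G_B and path space X=X_B. Let C={c_1,…,c_m}⊆X be a finite set such that the orbits G·c_1,…,G·c_m are pairwise disjoint. Then F(C) = {G°(Z) : Z⊆C} ∪ {{e}}, where the union over Z⊆C includes Z=∅ with G°(∅)=G. -/

import Mathlib

open MeasureTheory Filter
open scoped ENNReal ComplexOrder

noncomputable section

/-- A Bratteli diagram: vertex levels `V i`, edge levels `E i` (edges from `V i` to `V (i+1)`),
all levels finite and nonempty, a single root vertex, and source/range maps that are
surjective (every vertex emits and receives an edge). -/
structure BratteliDiagram where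
  V : ℕ → Type
  E : ℕ → Type
  fintypeV : ∀ i, Fintype (V i)
  fintypeE : ∀ i, Fintype (E i)
  nonemptyV : ∀ i, Nonempty (V i)
  nonemptyE : ∀ i, Nonempty (E i)
  subsingleton_root : Subsingleton (V 0)
  src : ∀ i, E i → V i
  rng : ∀ i, E i → V (i + 1)
  src_surj : ∀ i, Function.Surjective (src i)
  rng_surj : ∀ i, Function.Surjective (rng i)

namespace BratteliDiagram

variable (B : BratteliDiagram)

/-- The path space `X_B`: infinite paths starting at the root. -/
def Path : Type :=
  { x : ∀ i, B.E i // ∀ i, B.rng i (x i) = B.src (i + 1) (x (i + 1)) }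

instance (i : ℕ) : UniformSpace (B.E i) := ⊥

instance instUniformSpacePath : UniformSpace B.Path :=
  inferInstanceAs (UniformSpace { x : ∀ i, B.E i // ∀ i, B.rng i (x i) = B.src (i + 1) (x (i + 1)) })

instance instMeasurableSpacePath : MeasurableSpace B.Path := borel _

/-- Finite segments of `L+1` consecutive edges starting at level `n`. -/
def Seg (n L : ℕ) : Type :=
  { f : ∀ i : Fin (L + 1), B.E (n + (i : ℕ)) //
    ∀ (i : ℕ) (hi : i < L),
      B.rng (n + i) (f ⟨i, by omega⟩) = B.src (n + (i + 1)) (f ⟨i + 1, by omega⟩) }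

/-- The number of finite paths connecting `v ∈ V n` to `w ∈ V (n + L + 1)`. -/
def numPaths (n L : ℕ) (v : B.V n) (w : B.V (n + L + 1)) : ℕ :=
  Nat.card { f : B.Seg n L //
    B.src n (f.1 ⟨0, by omega⟩) = v ∧ B.rng (n + L) (f.1 ⟨L, by omega⟩) = w }

/-- A Bratteli diagram is simple if every vertex of a given level is connected
to every vertex of some deeper level. -/
def IsSimple : Prop :=
  ∀ n : ℕ, ∃ L : ℕ, ∀ (v : B.V n) (w : B.V (n + L + 1)), 0 < B.numPaths n L v w

/-- A Bratteli diagram is even if every vertex of a given level is connected to every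
vertex of some deeper level by a (positive) even number of paths. -/
def IsEven : Prop :=
  ∀ n : ℕ, ∃ L : ℕ, ∀ (v : B.V n) (w : B.V (n + L + 1)),
    0 < B.numPaths n L v w ∧ Even (B.numPaths n L v w)

/-- A permutation of the path space "of level `n`": it changes only the first `n` edges,
and what it does to the first `n` edges depends only on the first `n` edges. -/
def IsLevel (n : ℕ) (g : Equiv.Perm B.Path) : Prop :=
  (∀ (x : B.Path) (i : ℕ), n ≤ i → (g x).1 i = x.1 i) ∧
  (∀ x y : B.Path, (∀ i : ℕ, i < n → x.1 i = y.1 i) → ∀ i : ℕ, i < n → (g x).1 i = (g y).1 i)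

theorem isLevel_one (n : ℕ) : B.IsLevel n 1 :=
  ⟨fun _ _ _ => rfl, fun _ _ h i hi => h i hi⟩

theorem IsLevel.mul {n : ℕ} {a b : Equiv.Perm B.Path} (ha : B.IsLevel n a)
    (hb : B.IsLevel n b) : B.IsLevel n (a * b) := by
  constructor
  · intro x i hi
    have h1 := ha.1 (b x) i hi
    have h2 := hb.1 x i hi
    simpa [Equiv.Perm.mul_apply] using h1.trans h2
  · intro x y hxy i hi
    have h2 := hb.2 x y hxy
    have := ha.2 (b x) (b y) h2 i hi
    simpa [Equiv.Perm.mul_apply] using this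

theorem IsLevel.mono {n m : ℕ} (hnm : n ≤ m) {g : Equiv.Perm B.Path}
    (h : B.IsLevel n g) : B.IsLevel m g := by
  refine ⟨fun x i hi => h.1 x i (hnm.trans hi), fun x y hxy i hi => ?_⟩
  rcases lt_or_ge i n with h' | h'
  · exact h.2 x y (fun j hj => hxy j (hj.trans_le hnm)) i h'
  · rw [h.1 x i h', h.1 y i h']
    exact hxy i hi

/-- The group `G_n` of homeomorphisms of the path space permuting only the
first `n` edges of infinite paths. -/
def level (n : ℕ) : Subgroup (Equiv.Perm B.Path) where
  carrier := { g | B.IsLevel n g ∧ B.IsLevel n g⁻¹ }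
  one_mem' := ⟨B.isLevel_one n, by simpa using B.isLevel_one n⟩
  mul_mem' := by
    intro a b ha hb
    exact ⟨ha.1.mul B hb.1, by rw [mul_inv_rev]; exact IsLevel.mul B hb.2 ha.2⟩
  inv_mem' := by
    intro a ha
    exact ⟨ha.2, by simpa using ha.1⟩

theorem level_mono {n m : ℕ} (h : n ≤ m) : B.level n ≤ B.level m := by
  intro g hg
  exact ⟨hg.1.mono B h, hg.2.mono B h⟩

/-- The full group `G_B = ⋃ n, G_n` of the Bratteli diagram. -/
def fullGroup : Subgroup (Equiv.Perm B.Path) where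
  carrier := { g | ∃ n, g ∈ B.level n }
  one_mem' := ⟨0, one_mem _⟩
  mul_mem' := by
    rintro a b ⟨n, ha⟩ ⟨m, hb⟩
    exact ⟨max n m, mul_mem (B.level_mono (le_max_left n m) ha)
      (B.level_mono (le_max_right n m) hb)⟩
  inv_mem' := by
    rintro a ⟨n, ha⟩
    exact ⟨n, inv_mem ha⟩

/-- `G_n` viewed as a subgroup of the full group. -/
def levelIn (n : ℕ) : Subgroup ↥B.fullGroup := (B.level n).comap B.fullGroup.subtype

/-- The subgroup `G°(A)` of elements of the full group fixing `A` pointwise. -/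
def Gcirc (A : Set B.Path) : Subgroup ↥B.fullGroup :=
  ⨅ x ∈ A, MulAction.stabilizer ↥B.fullGroup x

/-- `G°_n(A) = G_n ∩ G°(A)`. -/
def GcircN (n : ℕ) (A : Set B.Path) : Subgroup ↥B.fullGroup :=
  B.levelIn n ⊓ B.Gcirc A

end BratteliDiagram

/-- Conjugation of a subgroup: `g • H = gHg⁻¹`. -/
def conjSub {Γ : Type*} [Group Γ] (g : Γ) (H : Subgroup Γ) : Subgroup Γ :=
  Subgroup.map (MulAut.conj g).toMonoidHom H

/-- The Borel structure on the space `Sub(Γ)` of subgroups of `Γ`,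
induced from the product space `{0,1}^Γ` (equivalently `Set Γ`). -/
instance subgroupMeasurableSpace {Γ : Type*} [Group Γ] : MeasurableSpace (Subgroup Γ) :=
  MeasurableSpace.comap (fun H => (H : Set Γ)) inferInstance

namespace BratteliDiagram

variable (B : BratteliDiagram)

/-- `F(A)`: the collection of subgroups of the full group normalized by `G°(A)`. -/
def FF (A : Set B.Path) : Set (Subgroup ↥B.fullGroup) :=
  { H | ∀ g ∈ B.Gcirc A, conjSub g H = H }

end BratteliDiagram

/-- A measure `ν` on `Y` is invariant under the action of `G`. -/
def MeasInv (G : Type*) [Group G] {Y : Type*} [MeasurableSpace Y] [MulAction G Y]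
    (ν : Measure Y) : Prop :=
  ∀ (g : G) (s : Set Y), MeasurableSet s → ν ((fun y => g • y) ⁻¹' s) = ν s

/-- The action of `G` on `(Y, ν)` is ergodic: every invariant measurable set is null or conull. -/
def MeasErg (G : Type*) [Group G] {Y : Type*} [MeasurableSpace Y] [MulAction G Y]
    (ν : Measure Y) : Prop :=
  ∀ s : Set Y, MeasurableSet s → (∀ g : G, (fun y => g • y) ⁻¹' s = s) → ν s = 0 ∨ ν s = 1

/-- An invariant random subgroup: a conjugation-invariant Borel probability measure on `Sub(G)`. -/
def IsIRS (G : Type*) [Group G] (φ : Measure (Subgroup G)) : Prop :=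
  IsProbabilityMeasure φ ∧
    ∀ (g : G) (s : Set (Subgroup G)), MeasurableSet s → φ (conjSub g ⁻¹' s) = φ s

/-- An ergodic invariant random subgroup. -/
def IsErgodicIRS (G : Type*) [Group G] (φ : Measure (Subgroup G)) : Prop :=
  IsIRS G φ ∧
    ∀ s : Set (Subgroup G), MeasurableSet s → (∀ g : G, conjSub g ⁻¹' s = s) →
      φ s = 0 ∨ φ s = 1

/-- A character of a group: normalized, central, positive semidefinite complex function. -/
def IsCharacter (G : Type*) [Group G] (χ : G → ℂ) : Prop :=
  χ 1 = 1 ∧ (∀ a b : G, χ (a * b) = χ (b * a)) ∧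
    ∀ (n : ℕ) (g : Fin n → G) (c : Fin n → ℂ),
      0 ≤ ∑ i, ∑ j, (starRingEnd ℂ) (c i) * c j * χ (g i * (g j)⁻¹)

namespace BratteliDiagram

variable (B : BratteliDiagram)

/-- The product measure `μ_α = μ_1^{α_1} × ⋯ × μ_k^{α_k}` on `X^{|α|}`,
realized on the index type `Σ i : Fin k, Fin (α i)` (of cardinality `|α| = Σ α i`). -/
def prodMeasure {k : ℕ} (μ : Fin k → Measure B.Path) (α : Fin k → ℕ) :
    Measure ((Σ i : Fin k, Fin (α i)) → B.Path) :=
  Measure.pi fun p => μ p.1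

/-- The stabilizer distribution `φ_α` of the diagonal action of the full group
on `(X^{|α|}, μ_α)`. -/
def stabDist {k : ℕ} (μ : Fin k → Measure B.Path) (α : Fin k → ℕ) :
    Measure (Subgroup ↥B.fullGroup) :=
  Measure.map (fun y => MulAction.stabilizer ↥B.fullGroup y) (B.prodMeasure μ α)

end BratteliDiagram

namespace BratteliDiagram

variable {B : BratteliDiagram}

/-- Agreement of two paths on the first `n` edges. -/
def Agr (n : ℕ) (x y : B.Path) : Prop := ∀ i, i < n → x.1 i = y.1 i

/-- The vertex of level `n` visited by a path. -/
def vtx (n : ℕ) (x : B.Path) : B.V n := B.src n (x.1 n)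

theorem Agr.refl (n : ℕ) (x : B.Path) : Agr n x x := fun _ _ => rfl

theorem Agr.symm {n : ℕ} {x y : B.Path} (h : Agr n x y) : Agr n y x :=
  fun i hi => (h i hi).symm

theorem Agr.trans {n : ℕ} {x y z : B.Path} (h : Agr n x y) (h' : Agr n y z) : Agr n x z :=
  fun i hi => (h i hi).trans (h' i hi)

theorem Agr.mono {n m : ℕ} (hnm : n ≤ m) {x y : B.Path} (h : Agr m x y) : Agr n x y :=
  fun i hi => h i (hi.trans_le hnm)

theorem Agr.vtx {n : ℕ} {x y : B.Path} (h : Agr n x y) : vtx n x = vtx n y := by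
  cases n with
  | zero => exact B.subsingleton_root.elim _ _
  | succ k =>
    have h1 := x.2 k
    have h2 := y.2 k
    have h3 := h k (Nat.lt_succ_self k)
    unfold BratteliDiagram.vtx
    rw [← h1, ← h2, h3]

theorem path_ext {x y : B.Path} (h : ∀ i, x.1 i = y.1 i) : x = y :=
  Subtype.ext (funext h)

theorem Agr.eq {n : ℕ} {x y : B.Path} (h : Agr n x y) (h' : ∀ i, n ≤ i → x.1 i = y.1 i) :
    x = y := by
  apply path_ext
  intro i
  rcases lt_or_ge i n with hi | hi
  · exact h i hi
  · exact h' i hi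

theorem exists_not_agr {x y : B.Path} (h : x ≠ y) : ∃ n, ∀ m, n ≤ m → ¬ Agr m x y := by
  by_contra hc
  push Not at hc
  apply h
  apply path_ext
  intro i
  obtain ⟨m, hm, ha⟩ := hc (i + 1)
  exact ha i (by omega)

theorem exists_not_agr_set {x : B.Path} {D : Set B.Path} (hD : D.Finite) :
    ∃ n, ∀ m, n ≤ m → ∀ d ∈ D, d ≠ x → ¬ Agr m x d := by
  induction D, hD using Set.Finite.induction_on with
  | empty => exact ⟨0, by simp⟩
  | @insert a s _ _ ih =>
    obtain ⟨n, hn⟩ := ih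
    by_cases hax : a = x
    · refine ⟨n, fun m hm d hd hdx => ?_⟩
      rcases hd with rfl | hd
      · exact absurd hax hdx
      · exact hn m hm d hd hdx
    · obtain ⟨k, hk⟩ := exists_not_agr (Ne.symm hax)
      refine ⟨max n k, fun m hm d hd hdx => ?_⟩
      rcases hd with rfl | hd
      · exact hk m ((le_max_right _ _).trans hm)
      · exact hn m ((le_max_left _ _).trans hm) d hd hdx

open Classical in
/-- Splice: first `n` edges of `x`, then the tail of `y`. -/
def spl (n : ℕ) (x y : B.Path) : B.Path :=
  if h : vtx n x = vtx n y then
    ⟨fun i => if i < n then x.1 i else y.1 i, by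
      intro i
      by_cases h1 : i + 1 < n
      · have : i < n := by omega
        simp only [h1, this, if_true]
        exact x.2 i
      · by_cases h2 : i < n
        · have h3 : n = i + 1 := by omega
          subst h3
          simp only [h2, if_true, lt_irrefl, if_false]
          rw [x.2 i]
          exact h
        · simp only [h1, h2, if_false]
          exact y.2 i⟩
  else y

theorem spl_lt {n : ℕ} {x y : B.Path} (h : vtx n x = vtx n y) {i : ℕ} (hi : i < n) :
    (spl n x y).1 i = x.1 i := by
  simp [spl, h, hi]

theorem spl_ge {n : ℕ} {x y : B.Path} {i : ℕ} (hi : n ≤ i) :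
    (spl n x y).1 i = y.1 i := by
  by_cases h : vtx n x = vtx n y
  · simp [spl, h, Nat.not_lt.2 hi]
  · simp [spl, h]

theorem spl_agr {n : ℕ} {x y : B.Path} (h : vtx n x = vtx n y) : Agr n (spl n x y) x :=
  fun _ hi => spl_lt h hi

theorem spl_vtx {n : ℕ} {x y : B.Path} : vtx n (spl n x y) = vtx n y := by
  unfold vtx
  rw [spl_ge le_rfl]

theorem spl_eq {n : ℕ} {x y z : B.Path} (h : Agr n z x) (h' : ∀ i, n ≤ i → z.1 i = y.1 i) :
    spl n x y = z := by
  have hv : vtx n x = vtx n y := by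
    rw [← h.vtx]; unfold vtx; rw [h' n le_rfl]
  refine Agr.eq ((spl_agr hv).trans h.symm) fun i hi => ?_
  rw [spl_ge hi, h' i hi]

open Classical in
/-- The transposition of two prefixes of length `n`, as a map. -/
def tr (n : ℕ) (x y z : B.Path) : B.Path :=
  if Agr n z x then spl n y z else if Agr n z y then spl n x z else z

theorem tr_left {n : ℕ} {x y z : B.Path} (h : Agr n z x) : tr n x y z = spl n y z := by
  simp [tr, h]

theorem tr_right {n : ℕ} {x y z : B.Path} (h : Agr n z y) :
    tr n x y z = spl n x z := by
  unfold tr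
  split_ifs with h1
  · rw [spl_eq h (fun _ _ => rfl), spl_eq h1 (fun _ _ => rfl)]
  · rfl

theorem tr_off {n : ℕ} {x y z : B.Path} (h : ¬ Agr n z x) (h' : ¬ Agr n z y) :
    tr n x y z = z := by
  simp [tr, h, h']

theorem tr_ge {n : ℕ} {x y z : B.Path} {i : ℕ} (hi : n ≤ i) : (tr n x y z).1 i = z.1 i := by
  unfold tr
  split_ifs
  · exact spl_ge hi
  · exact spl_ge hi
  · rfl

theorem tr_invol {n : ℕ} {x y : B.Path} (hv : vtx n x = vtx n y) :
    Function.Involutive (tr n x y) := by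
  intro z
  by_cases h1 : Agr n z x
  · have : Agr n (tr n x y z) y := by
      rw [tr_left h1]; exact spl_agr (by rw [h1.vtx, hv])
    rw [tr_right this]
    exact spl_eq h1 fun i hi => (tr_ge hi).symm
  · by_cases h2 : Agr n z y
    · have : Agr n (tr n x y z) x := by
        rw [tr_right h2]; exact spl_agr (by rw [h2.vtx, hv])
      rw [tr_left this]
      exact spl_eq h2 fun i hi => (tr_ge hi).symm
    · rw [tr_off h1 h2, tr_off h1 h2]

theorem tr_agr {n : ℕ} {x y : B.Path} (hv : vtx n x = vtx n y) {z z' : B.Path}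
    (h : Agr n z z') : Agr n (tr n x y z) (tr n x y z') := by
  by_cases h1 : Agr n z x
  · have h1' := h.symm.trans h1
    rw [tr_left h1, tr_left h1']
    exact (spl_agr (by rw [h1.vtx, hv])).trans (spl_agr (by rw [h1'.vtx, hv])).symm
  · have h1' : ¬ Agr n z' x := fun h' => h1 (h.trans h')
    by_cases h2 : Agr n z y
    · have h2' := h.symm.trans h2
      rw [tr_right h2, tr_right h2']
      exact (spl_agr (by rw [h2.vtx, hv])).trans (spl_agr (by rw [h2'.vtx, hv])).symm
    · have h2' : ¬ Agr n z' y := fun h' => h2 (h.trans h')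
      rw [tr_off h1 h2, tr_off h1' h2']
      exact h

theorem toPerm_mem_level {n : ℕ} {f : B.Path → B.Path} (hf : Function.Involutive f)
    (h1 : ∀ z i, n ≤ i → (f z).1 i = z.1 i)
    (h2 : ∀ z z', Agr n z z' → Agr n (f z) (f z')) : hf.toPerm f ∈ B.level n := by
  have key : B.IsLevel n (hf.toPerm f) := ⟨h1, h2⟩
  refine ⟨key, ?_⟩
  have : (hf.toPerm f)⁻¹ = hf.toPerm f := hf.toPerm_symm
  rw [this]
  exact key

open Classical in
/-- The transposition of two prefixes of length `n`, as a permutation. -/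
def T (n : ℕ) (x y : B.Path) : Equiv.Perm B.Path :=
  if hv : vtx n x = vtx n y then (tr_invol hv).toPerm _ else 1

theorem T_apply {n : ℕ} {x y : B.Path} (hv : vtx n x = vtx n y) (z : B.Path) :
    T n x y z = tr n x y z := by
  simp [T, hv]

theorem T_level {n : ℕ} (x y : B.Path) : T n x y ∈ B.level n := by
  unfold T
  split_ifs with hv
  · exact toPerm_mem_level _ (fun z i hi => tr_ge hi) (fun z z' h => tr_agr hv h)
  · exact one_mem _

theorem T_off {n : ℕ} {x y z : B.Path} (h : ¬ Agr n z x) (h' : ¬ Agr n z y) :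
    T n x y z = z := by
  by_cases hv : vtx n x = vtx n y
  · rw [T_apply hv, tr_off h h']
  · simp [T, hv]

theorem T_left {n : ℕ} {x y z : B.Path} (hv : vtx n x = vtx n y) (h : Agr n z x) :
    Agr n (T n x y z) y := by
  rw [T_apply hv, tr_left h]; exact spl_agr (by rw [h.vtx, hv])

theorem level_agr {n : ℕ} {g : Equiv.Perm B.Path} (hg : g ∈ B.level n) {x y : B.Path}
    (h : Agr n x y) : Agr n (g x) (g y) := hg.1.2 x y h

theorem level_agr_iff {n : ℕ} {g : Equiv.Perm B.Path} (hg : g ∈ B.level n) {x y : B.Path} :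
    Agr n (g x) (g y) ↔ Agr n x y := by
  refine ⟨fun h => ?_, level_agr hg⟩
  have := level_agr (inv_mem hg) h
  simpa using this

theorem level_ge {n : ℕ} {g : Equiv.Perm B.Path} (hg : g ∈ B.level n) (x : B.Path)
    {i : ℕ} (hi : n ≤ i) : (g x).1 i = x.1 i := hg.1.1 x i hi

theorem level_vtx {n : ℕ} {g : Equiv.Perm B.Path} (hg : g ∈ B.level n) (x : B.Path) :
    vtx n (g x) = vtx n x := by
  unfold vtx
  rw [level_ge hg x le_rfl]

theorem level_fix {n : ℕ} {g : Equiv.Perm B.Path} (hg : g ∈ B.level n) {x y : B.Path}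
    (h : Agr n x y) (hy : g y = y) : g x = x := by
  refine Agr.eq (n := n) ?_ fun i hi => level_ge hg x hi
  have := level_agr hg h
  rw [hy] at this
  exact this.trans h.symm

theorem T_congr {n : ℕ} {x y x' y' : B.Path} (hx : Agr n x x') (hy : Agr n y y') :
    T n x y = T n x' y' := by
  by_cases hv : vtx n x = vtx n y
  · have hv' : vtx n x' = vtx n y' := by rw [← hx.vtx, ← hy.vtx, hv]
    ext1 z
    rw [T_apply hv, T_apply hv']
    by_cases h1 : Agr n z x
    · rw [tr_left h1, tr_left (h1.trans hx)]
      refine (spl_eq ?_ fun i hi => spl_ge hi)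
      exact (spl_agr (by rw [h1.vtx, hx.vtx, hv'])).trans hy.symm
    · have h1' : ¬ Agr n z x' := fun h => h1 (h.trans hx.symm)
      by_cases h2 : Agr n z y
      · rw [tr_right h2, tr_right (h2.trans hy)]
        refine (spl_eq ?_ fun i hi => spl_ge hi)
        exact (spl_agr (by rw [h2.vtx, hy.vtx, hv'])).trans hx.symm
      · have h2' : ¬ Agr n z y' := fun h => h2 (h.trans hy.symm)
        rw [tr_off h1 h2, tr_off h1' h2']
  · have hv' : ¬ vtx n x' = vtx n y' := by rw [← hx.vtx, ← hy.vtx]; exact hv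
    simp [T, hv, hv']

theorem T_comm {n : ℕ} (x y : B.Path) : T n x y = T n y x := by
  by_cases hv : vtx n x = vtx n y
  · ext1 z
    rw [T_apply hv, T_apply hv.symm]
    by_cases h1 : Agr n z x
    · rw [tr_left h1, tr_right h1]
    · by_cases h2 : Agr n z y
      · rw [tr_right h2, tr_left h2]
      · rw [tr_off h1 h2, tr_off h2 h1]
  · have hv' : ¬ vtx n y = vtx n x := fun h => hv h.symm
    simp [T, hv, hv']

theorem T_self {n : ℕ} {x y : B.Path} (h : Agr n x y) : T n x y = 1 := by
  ext1 z
  rw [T_apply h.vtx]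
  by_cases h1 : Agr n z x
  · rw [tr_left h1]
    exact spl_eq (h1.trans h) fun _ _ => rfl
  · rw [tr_off h1 fun h2 => h1 (h2.trans h.symm)]
    rfl

theorem T_conj {n : ℕ} {g : Equiv.Perm B.Path} (hg : g ∈ B.level n) (x y : B.Path) :
    g * T n x y * g⁻¹ = T n (g x) (g y) := by
  rw [mul_inv_eq_iff_eq_mul]
  by_cases hv : vtx n x = vtx n y
  · have hv' : vtx n (g x) = vtx n (g y) := by rw [level_vtx hg, level_vtx hg, hv]
    ext1 z
    rw [Equiv.Perm.mul_apply, Equiv.Perm.mul_apply, T_apply hv, T_apply hv']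
    by_cases h1 : Agr n z x
    · rw [tr_left h1, tr_left ((level_agr_iff hg).2 h1)]
      symm
      apply spl_eq
      · exact level_agr hg (spl_agr (by rw [h1.vtx, hv]))
      · intro i hi
        rw [level_ge hg _ hi, level_ge hg _ hi, spl_ge hi]
    · by_cases h2 : Agr n z y
      · rw [tr_right h2, tr_right ((level_agr_iff hg).2 h2)]
        symm
        apply spl_eq
        · exact level_agr hg (spl_agr (by rw [h2.vtx, hv]))
        · intro i hi
          rw [level_ge hg _ hi, level_ge hg _ hi, spl_ge hi]
      · rw [tr_off h1 h2, tr_off (fun h => h1 ((level_agr_iff hg).1 h))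
          (fun h => h2 ((level_agr_iff hg).1 h))]
  · have hv' : ¬ vtx n (g x) = vtx n (g y) := by rw [level_vtx hg, level_vtx hg]; exact hv
    simp [T, hv, hv']

theorem T_inv {n : ℕ} (x y : B.Path) : (T n x y)⁻¹ = T n x y := by
  unfold T
  split_ifs with hv
  · exact (tr_invol hv).toPerm_symm
  · simp

/-- Pointwise fixator of `C` in the full group, as a group of permutations. -/
def fixG (C : Set B.Path) : Subgroup (Equiv.Perm B.Path) where
  carrier := { g | g ∈ B.fullGroup ∧ ∀ x ∈ C, g x = x }
  one_mem' := ⟨one_mem _, fun _ _ => rfl⟩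
  mul_mem' := by
    rintro a b ⟨ha, ha'⟩ ⟨hb, hb'⟩
    refine ⟨mul_mem ha hb, fun x hx => ?_⟩
    rw [Equiv.Perm.mul_apply, hb' x hx, ha' x hx]
  inv_mem' := by
    rintro a ⟨ha, ha'⟩
    refine ⟨inv_mem ha, fun x hx => ?_⟩
    rw [Equiv.Perm.inv_eq_iff_eq, ha' x hx]

theorem T_fixG {n : ℕ} {x y : B.Path} {C : Set B.Path} (hx : ∀ d ∈ C, ¬ Agr n d x)
    (hy : ∀ d ∈ C, ¬ Agr n d y) : T n x y ∈ fixG C :=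
  ⟨⟨n, T_level x y⟩, fun d hd => T_off (hx d hd) (hy d hd)⟩

/-- Transport lemma. -/
theorem transport {y z : B.Path} (hyz : ∃ g ∈ B.fullGroup, g y = z) {D : Set B.Path}
    (hD : D.Finite) (hy : y ∉ D) (hz : z ∉ D) : ∃ a ∈ fixG D, a y = z := by
  obtain ⟨g, ⟨k, hg⟩, rfl⟩ := hyz
  obtain ⟨n1, h1⟩ := exists_not_agr_set (x := y) hD
  obtain ⟨n2, h2⟩ := exists_not_agr_set (x := g y) hD
  set n := max k (max n1 n2) with hn
  have hg' := B.level_mono (show k ≤ n by omega) hg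
  refine ⟨T n y (g y), T_fixG ?_ ?_, ?_⟩
  · intro d hd h
    exact h1 n (by omega) d hd (fun e => hy (e ▸ hd)) h.symm
  · intro d hd h
    exact h2 n (by omega) d hd (fun e => hz (e ▸ hd)) h.symm
  · rw [T_apply (level_vtx hg' y).symm, tr_left (Agr.refl n y)]
    exact spl_eq (Agr.refl _ _) fun i hi => level_ge hg' y hi

theorem gen_level {n : ℕ} {C : Set B.Path} (M : Subgroup (Equiv.Perm B.Path))
    (hM : ∀ x y : B.Path, vtx n x = vtx n y → (∀ d ∈ C, ¬ Agr n d x) →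
      (∀ d ∈ C, ¬ Agr n d y) → T n x y ∈ M)
    (g : Equiv.Perm B.Path) (hg : g ∈ B.level n) (hC : ∀ x ∈ C, g x = x) : g ∈ M := by
  let res : B.Path → (∀ i : Fin n, B.E i) := fun x i => x.1 i
  have hres : ∀ x y, res x = res y ↔ Agr n x y := by
    intro x y
    constructor
    · intro h i hi
      exact congrFun h ⟨i, hi⟩
    · intro h
      funext i
      exact h i i.2
  have : ∀ i, Fintype (B.E i) := B.fintypeE
  have : ∀ i, Finite (B.E i) := fun i => inferInstance
  induction hk : (res '' {x | g x ≠ x}).ncard using Nat.strong_induction_on generalizing g with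
  | _ k ih =>
    by_cases h1 : ∀ x, g x = x
    · have : g = 1 := Equiv.ext h1
      rw [this]; exact one_mem _
    · push Not at h1
      obtain ⟨x, hx⟩ := h1
      have hv : vtx n x = vtx n (g x) := (level_vtx hg x).symm
      have hCx : ∀ d ∈ C, ¬ Agr n d x := by
        intro d hd h
        exact hx (level_fix hg h.symm (hC d hd))
      have hCgx : ∀ d ∈ C, ¬ Agr n d (g x) := by
        intro d hd h
        apply hCx d hd
        rw [← level_agr_iff hg, hC d hd]
        exact h
      have hT := hM x (g x) hv hCx hCgx
      have hTx : (T n x (g x) * g) x = x := by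
        rw [Equiv.Perm.mul_apply, T_apply hv, tr_right (Agr.refl _ _)]
        exact spl_eq (Agr.refl _ _) fun i hi => (level_ge hg x hi).symm
      have hlev : T n x (g x) * g ∈ B.level n := mul_mem (T_level _ _) hg
      have hsub : res '' {z | (T n x (g x) * g) z ≠ z} ⊂ res '' {z | g z ≠ z} := by
        rw [Set.ssubset_iff_of_subset]
        · refine ⟨res x, ⟨x, hx, rfl⟩, ?_⟩
          rintro ⟨z, hz, hzx⟩
          exact hz (level_fix hlev ((hres _ _).1 hzx) hTx)
        · apply Set.image_mono
          intro z hz hgz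
          apply hz
          rw [Equiv.Perm.mul_apply, hgz]
          apply T_off
          · intro h
            exact hx (level_fix hg h.symm hgz)
          · intro h
            rw [← hgz, level_agr_iff hg] at h
            exact hx (level_fix hg h.symm hgz)
      have := ih _ (by rw [← hk]; exact Set.ncard_lt_ncard hsub (Set.toFinite _))
        (T n x (g x) * g) hlev (fun d hd => by
          rw [Equiv.Perm.mul_apply, hC d hd]; exact T_off (hCx d hd) (hCgx d hd)) rfl
      exact (Subgroup.mul_mem_cancel_left M hT).1 this

theorem glue {n L : ℕ} (x y : B.Path) (f : B.Seg n L)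
    (h1 : B.src n (f.1 ⟨0, by omega⟩) = vtx n x)
    (h2 : B.rng (n + L) (f.1 ⟨L, by omega⟩) = vtx (n + L + 1) y) :
    ∃ z : B.Path, (∀ i, i < n → z.1 i = x.1 i) ∧
      (∀ (i : ℕ) (hi : i < L + 1), z.1 (n + i) = f.1 ⟨i, hi⟩) ∧
      ∀ i, n + L + 1 ≤ i → z.1 i = y.1 i := by
  classical
  let u : ∀ i, B.E i := fun i =>
    if h : ∃ j : Fin (L + 1), n + (j : ℕ) = i then h.choose_spec ▸ f.1 h.choose
    else if i < n then x.1 i else y.1 i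
  have u1 : ∀ i, i < n → u i = x.1 i := by
    intro i hi
    have : ¬ ∃ j : Fin (L + 1), n + (j : ℕ) = i := by
      rintro ⟨j, hj⟩; omega
    simp only [u, this, dif_neg, not_false_eq_true, hi, if_true]
  have u3 : ∀ i, n + L + 1 ≤ i → u i = y.1 i := by
    intro i hi
    have h' : ¬ ∃ j : Fin (L + 1), n + (j : ℕ) = i := by
      rintro ⟨j, hj⟩; omega
    have h'' : ¬ i < n := by omega
    simp only [u, h', dif_neg, not_false_eq_true, h'', if_false]
  have u2 : ∀ (i : ℕ) (hi : i < L + 1), u (n + i) = f.1 ⟨i, hi⟩ := by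
    intro i hi
    have h : ∃ j : Fin (L + 1), n + (j : ℕ) = n + i := ⟨⟨i, hi⟩, rfl⟩
    have gen : ∀ (j : Fin (L + 1)) (hj : n + (j : ℕ) = n + i),
        (hj ▸ f.1 j : B.E (n + i)) = f.1 ⟨i, hi⟩ := by
      intro j hj
      have : j = ⟨i, hi⟩ := Fin.ext (by simpa using hj)
      subst this
      rfl
    simp only [u, h, dif_pos]
    exact gen _ _
  refine ⟨⟨u, ?_⟩, u1, u2, u3⟩
  intro i
  rcases lt_or_ge i n with hi | hi
  · rcases Nat.lt_or_ge (i + 1) n with hi' | hi'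
    · rw [u1 i hi, u1 (i + 1) hi']; exact x.2 i
    · have h3 : n = i + 1 := by omega
      subst h3
      have := u2 0 (by omega)
      rw [u1 i hi, x.2 i]
      refine h1.symm.trans ?_
      exact congrArg _ this.symm
  · obtain ⟨j, rfl⟩ := Nat.exists_eq_add_of_le hi
    rcases Nat.lt_trichotomy j L with hj | hj | hj
    · have e1 := u2 j (by omega)
      have e2 := u2 (j + 1) (by omega)
      have := f.2 j hj
      rw [← e1, ← e2] at this
      exact this
    · subst hj
      rw [u2 j (by omega), u3 (n + j + 1) (by omega)]
      exact h2
    · rw [u3 (n + j) (by omega), u3 (n + j + 1) (by omega)]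
      exact y.2 _

/-- The segment of a path. -/
def seg (n L : ℕ) (z : B.Path) : B.Seg n L :=
  ⟨fun i => z.1 (n + (i : ℕ)), fun i _ => z.2 (n + i)⟩

instance segFinite (n L : ℕ) : Finite (B.Seg n L) := by
  have : ∀ i, Fintype (B.E i) := B.fintypeE
  have : ∀ i, Finite (B.E i) := fun i => inferInstance
  unfold Seg
  infer_instance

/-- Two continuations. -/
theorem two_cont (heven : B.IsEven) (n : ℕ) : ∃ m, n ≤ m ∧ ∀ x y : B.Path,
    ∃ z1 z2 : B.Path, z1 ≠ z2 ∧ Agr n z1 x ∧ Agr n z2 x ∧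
      (∀ i, m ≤ i → z1.1 i = y.1 i) ∧ (∀ i, m ≤ i → z2.1 i = y.1 i) := by
  obtain ⟨L, hL⟩ := heven n
  refine ⟨n + L + 1, by omega, fun x y => ?_⟩
  obtain ⟨hpos, hev⟩ := hL (vtx n x) (vtx (n + L + 1) y)
  have h2 : 1 < B.numPaths n L (vtx n x) (vtx (n + L + 1) y) := by
    rcases hev with ⟨k, hk⟩
    omega
  unfold numPaths at h2
  rw [Finite.one_lt_card_iff_nontrivial] at h2
  obtain ⟨f1, f2, hf⟩ := h2
  obtain ⟨z1, a1, b1, c1⟩ := glue x y f1.1 f1.2.1 f1.2.2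
  obtain ⟨z2, a2, b2, c2⟩ := glue x y f2.1 f2.2.1 f2.2.2
  refine ⟨z1, z2, ?_, a1, a2, c1, c2⟩
  rintro rfl
  apply hf
  apply Subtype.ext
  apply Subtype.ext
  funext i
  rw [← b1 i i.2, ← b2 i i.2]

theorem three_cont (heven : B.IsEven) (n : ℕ) : ∃ m, n ≤ m ∧ ∀ x y : B.Path,
    ∃ z1 z2 z3 : B.Path, z1 ≠ z2 ∧ z1 ≠ z3 ∧ z2 ≠ z3 ∧ Agr n z1 x ∧ Agr n z2 x ∧ Agr n z3 x ∧
      (∀ i, m ≤ i → z1.1 i = y.1 i) ∧ (∀ i, m ≤ i → z2.1 i = y.1 i) ∧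
      (∀ i, m ≤ i → z3.1 i = y.1 i) := by
  obtain ⟨m1, hm1, H1⟩ := two_cont heven n
  obtain ⟨m2, hm2, H2⟩ := two_cont heven m1
  refine ⟨m2, hm1.trans hm2, fun x y => ?_⟩
  obtain ⟨w1, w2, hw, a1, a2, t1, t2⟩ := H2 x y
  obtain ⟨z1, z2, hz, b1, b2, s1, s2⟩ := H1 x w1
  obtain ⟨z3, _, _, b3, _, s3, _⟩ := H1 x w2
  have key : ∀ z : B.Path, (∀ i, m1 ≤ i → z.1 i = w1.1 i) → z ≠ z3 := by
    rintro z hzz rfl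
    apply hw
    exact Agr.eq (a1.trans a2.symm) fun i hi => by rw [← hzz i hi, s3 i hi]
  refine ⟨z1, z2, z3, hz, key z1 s1, key z2 s2, b1, b2, b3, ?_, ?_, ?_⟩
  · intro i hi; rw [s1 i (hm2.trans hi), t1 i hi]
  · intro i hi; rw [s2 i (hm2.trans hi), t1 i hi]
  · intro i hi; rw [s3 i (hm2.trans hi), t2 i hi]

/-- Points of the orbit of `x` near `x` avoiding a finite set. -/
theorem avoid (heven : B.IsEven) (n : ℕ) (x : B.Path) {D : Set B.Path} (hD : D.Finite) :
    ∃ z, Agr n z x ∧ z ∉ D ∧ ∃ g ∈ B.fullGroup, g x = z := by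
  obtain ⟨k, hk⟩ := exists_not_agr_set (x := x) hD
  obtain ⟨m, hm, H⟩ := two_cont heven (max n k)
  obtain ⟨z1, z2, hz, a1, a2, t1, t2⟩ := H x x
  have : ∃ z, z ≠ x ∧ Agr (max n k) z x ∧ ∀ i, m ≤ i → z.1 i = x.1 i := by
    by_cases h : z1 = x
    · exact ⟨z2, fun e => hz (h.trans e.symm), a2, t2⟩
    · exact ⟨z1, h, a1, t1⟩
  obtain ⟨z, hzx, ha, ht⟩ := this
  refine ⟨z, ha.mono (le_max_left _ _), ?_, T m x z, ⟨m, T_level _ _⟩, ?_⟩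
  · intro hzD
    exact hk _ (le_max_right n k) z hzD hzx ha.symm
  · have hv : vtx m x = vtx m z := by unfold vtx; rw [ht m le_rfl]
    rw [T_apply hv, tr_left (Agr.refl _ _)]
    exact spl_eq (Agr.refl _ _) ht

theorem fiber_invol {S W : Type} [Finite S] (f : S → W)
    (h : ∀ w, Even (Nat.card {s // f s = w})) :
    ∃ (τ : S → S) (hf : S → Bool), (∀ s, f (τ s) = f s) ∧ (∀ s, τ (τ s) = s) ∧
      ∀ s, hf (τ s) = !hf s := by
  have h' : ∀ w, ∃ k : ℕ, Nonempty ({s // f s = w} ≃ Bool × Fin k) := by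
    intro w
    obtain ⟨k, hk⟩ := h w
    refine ⟨k, Finite.card_eq.1 ?_⟩
    rw [hk, Nat.card_prod]
    simp
    omega
  choose k hk using h'
  let e : ∀ w, {s // f s = w} ≃ Bool × Fin (k w) := fun w => (hk w).some
  let flip : ∀ w, {s // f s = w} → {s // f s = w} := fun w s =>
    (e w).symm (!(e w s).1, (e w s).2)
  have key : ∀ w (s : S) (hs : f s = w), (flip (f s) ⟨s, rfl⟩).1 = (flip w ⟨s, hs⟩).1 := by
    rintro w s rfl; rfl
  have key2 : ∀ w (s : S) (hs : f s = w), (e (f s) ⟨s, rfl⟩).1 = (e w ⟨s, hs⟩).1 := by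
    rintro w s rfl; rfl
  refine ⟨fun s => (flip (f s) ⟨s, rfl⟩).1, fun s => (e (f s) ⟨s, rfl⟩).1, ?_, ?_, ?_⟩
  · intro s
    exact (flip (f s) ⟨s, rfl⟩).2
  · intro s
    dsimp only
    rw [key (f s) _ (flip (f s) ⟨s, rfl⟩).2]
    simp [flip]
  · intro s
    dsimp only
    rw [key2 (f s) _ (flip (f s) ⟨s, rfl⟩).2]
    simp [flip]

theorem even_tau (heven : B.IsEven) (n : ℕ) : ∃ m, n ≤ m ∧
    ∃ (τ : B.Path → B.Path) (hf : B.Path → Prop),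
      (∀ z, τ (τ z) = z) ∧
      (∀ z i, i < n ∨ m ≤ i → (τ z).1 i = z.1 i) ∧
      (∀ z z', (∀ i, n ≤ i → i < m → z.1 i = z'.1 i) →
        ∀ i, n ≤ i → i < m → (τ z).1 i = (τ z').1 i) ∧
      (∀ z, hf (τ z) ↔ ¬ hf z) ∧
      (∀ z z', (∀ i, n ≤ i → i < m → z.1 i = z'.1 i) → (hf z ↔ hf z')) := by
  obtain ⟨L, hL⟩ := heven n
  let F : B.Seg n L → B.V n × B.V (n + L + 1) := fun f =>
    (B.src n (f.1 ⟨0, by omega⟩), B.rng (n + L) (f.1 ⟨L, by omega⟩))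
  have hF : ∀ w, Even (Nat.card {s // F s = w}) := by
    rintro ⟨v, w⟩
    have := (hL v w).2
    unfold numPaths at this
    convert this using 6
    simp [F]
  obtain ⟨t, hf, t1, t2, t3⟩ := fiber_invol F hF
  have hsrc : ∀ z : B.Path, B.src n ((t (seg n L z)).1 ⟨0, by omega⟩) = vtx n z := by
    intro z
    exact congrArg Prod.fst (t1 (seg n L z))
  have hrng : ∀ z : B.Path, B.rng (n + L) ((t (seg n L z)).1 ⟨L, by omega⟩)
      = vtx (n + L + 1) z := by
    intro z
    refine (congrArg Prod.snd (t1 (seg n L z))).trans ?_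
    exact z.2 (n + L)
  choose τ a b c using fun z => glue z z (t (seg n L z)) (hsrc z) (hrng z)
  have hseg : ∀ z, seg n L (τ z) = t (seg n L z) := by
    intro z
    apply Subtype.ext
    funext i
    exact b z i i.2
  have hsegc : ∀ z z' : B.Path, (∀ i, n ≤ i → i < n + L + 1 → z.1 i = z'.1 i) →
      seg n L z = seg n L z' := by
    intro z z' h
    apply Subtype.ext
    funext i
    exact h _ (by omega) (by have := i.2; omega)
  refine ⟨n + L + 1, by omega, τ, fun z => hf (seg n L z) = true, ?_, ?_, ?_, ?_, ?_⟩
  · intro z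
    apply path_ext
    intro i
    rcases lt_or_ge i n with hi | hi
    · rw [a _ i hi, a _ i hi]
    · rcases lt_or_ge i (n + L + 1) with hi' | hi'
      · obtain ⟨j, rfl⟩ := Nat.exists_eq_add_of_le hi
        rw [b _ j (by omega), hseg, t2]
        rfl
      · rw [c _ i hi', c _ i hi']
  · rintro z i (hi | hi)
    · exact a z i hi
    · exact c z i hi
  · intro z z' h i hi hi'
    obtain ⟨j, rfl⟩ := Nat.exists_eq_add_of_le hi
    rw [b z j (by omega), b z' j (by omega), hsegc z z' h]
  · intro z
    dsimp only
    rw [hseg, t3]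
    simp
  · intro z z' h
    have e := hsegc z z' h
    dsimp only
    rw [e]

/-- Transpositions are commutators. -/
theorem T_commutator (heven : B.IsEven) {n : ℕ} {C : Set B.Path} {x y : B.Path}
    (hv : vtx n x = vtx n y) (hx : ∀ d ∈ C, ¬ Agr n d x) (hy : ∀ d ∈ C, ¬ Agr n d y) :
    ∃ a ∈ fixG C, ∃ b ∈ fixG C, T n x y = a * b * a⁻¹ * b⁻¹ := by
  classical
  obtain ⟨m, hnm, τ, hf, τ1, τ2, τ3, h1, h2⟩ := even_tau heven n
  let fa : B.Path → B.Path := fun z => if hf z then tr n x y z else z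
  let P : B.Path → Prop := fun z => Agr n z x ∨ Agr n z y
  let fb : B.Path → B.Path := fun z => if P z then τ z else z
  have hftr : ∀ z, hf (tr n x y z) ↔ hf z := fun z => h2 _ _ fun i hi _ => tr_ge hi
  have τagr : ∀ z, Agr n (τ z) z := fun z i hi => τ2 z i (Or.inl hi)
  have Pτ : ∀ z, P (τ z) ↔ P z := by
    intro z
    have e : ∀ w, Agr n (τ z) w ↔ Agr n z w := fun w =>
      ⟨fun h => (τagr z).symm.trans h, fun h => (τagr z).trans h⟩
    simp only [P, e]
  have Ptr : ∀ z, P z → P (tr n x y z) := by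
    rintro z (h | h)
    · right; rw [tr_left h]; exact spl_agr (by rw [h.vtx, hv])
    · left; rw [tr_right h]; exact spl_agr (by rw [h.vtx, hv])
  have ia : Function.Involutive fa := by
    intro z
    by_cases h : hf z
    · have h' := (hftr z).2 h
      simp only [fa, h, h', if_true]
      exact tr_invol hv z
    · simp only [fa, h, if_false]
  have ib : Function.Involutive fb := by
    intro z
    by_cases h : P z
    · have h' := (Pτ z).2 h
      simp only [fb, h, h', if_true]
      exact τ1 z
    · simp only [fb, h, if_false]
  have la : ia.toPerm fa ∈ B.level m := by
    apply toPerm_mem_level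
    · intro z i hi
      simp only [fa]
      split_ifs
      · exact tr_ge (hnm.trans hi)
      · rfl
    · intro z z' h
      have hh := h2 z z' fun i _ hi => h i hi
      by_cases h' : hf z
      · simp only [fa, h', hh.1 h', if_true]
        intro i hi
        rcases lt_or_ge i n with hi' | hi'
        · exact tr_agr hv (h.mono hnm) i hi'
        · rw [tr_ge hi', tr_ge hi', h i hi]
      · have h'' : ¬ hf z' := fun e => h' (hh.2 e)
        simp only [fa, h', h'', if_false]
        exact h
  have lb : ib.toPerm fb ∈ B.level m := by
    apply toPerm_mem_level
    · intro z i hi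
      simp only [fb]
      split_ifs
      · exact τ2 z i (Or.inr hi)
      · rfl
    · intro z z' h
      have hh : P z ↔ P z' := by
        have h0 := h.mono hnm
        have e : ∀ w, Agr n z w ↔ Agr n z' w := fun w =>
          ⟨fun h => h0.symm.trans h, fun h => h0.trans h⟩
        simp only [P, e]
      by_cases h' : P z
      · simp only [fb, h', hh.1 h', if_true]
        intro i hi
        rcases lt_or_ge i n with hi' | hi'
        · rw [τ2 z i (Or.inl hi'), τ2 z' i (Or.inl hi'), h i hi]
        · exact τ3 z z' (fun i _ hi => h i hi) i hi' hi
      · have h'' : ¬ P z' := fun e => h' (hh.2 e)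
        simp only [fb, h', h'', if_false]
        exact h
  refine ⟨ia.toPerm fa, ⟨⟨m, la⟩, fun d hd => ?_⟩, ib.toPerm fb, ⟨⟨m, lb⟩, fun d hd => ?_⟩, ?_⟩
  · change fa d = d
    simp only [fa]
    rw [tr_off (hx d hd) (hy d hd)]
    simp
  · change fb d = d
    have : ¬ P d := by rintro (h | h); exacts [hx d hd h, hy d hd h]
    simp only [fb, this, if_false]
  · have e1 : (ia.toPerm fa)⁻¹ = ia.toPerm fa := ia.toPerm_symm
    have e2 : (ib.toPerm fb)⁻¹ = ib.toPerm fb := ib.toPerm_symm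
    rw [e1, e2]
    ext1 z
    rw [T_apply hv]
    change tr n x y z = fa (fb (fa (fb z)))
    by_cases hP : P z
    · by_cases hh : hf z
      · have h3 : ¬ hf (τ z) := fun e => (h1 z).1 e hh
        have h4 := (Pτ z).2 hP
        simp only [fb, hP, if_true, fa, h3, if_false, h4, τ1, hh]
      · have h3 : hf (τ z) := (h1 z).2 hh
        have h4 := Ptr _ ((Pτ z).2 hP)
        have h5 : ¬ hf (τ (tr n x y (τ z))) := by
          rw [h1, hftr]; exact fun e => e h3
        simp only [fb, hP, if_true, fa, h3, h4, h5, if_false]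
        apply Agr.eq (n := n)
        · exact ((τagr _).trans (tr_agr hv (τagr z))).symm
        · intro i hi
          rw [tr_ge hi]
          rcases lt_or_ge i m with hi' | hi'
          · rw [τ3 (tr n x y (τ z)) (τ z) (fun j hj _ => tr_ge hj) i hi hi', τ1]
          · rw [τ2 _ i (Or.inr hi'), tr_ge hi, τ2 _ i (Or.inr hi')]
    · have h0 : tr n x y z = z := tr_off (fun h => hP (Or.inl h)) (fun h => hP (Or.inr h))
      simp only [fb, hP, if_false, fa, h0, ite_self]

/-- The subgroup of elements of `K` commuting with `t` modulo `N`. -/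
def commSub (N K : Subgroup (Equiv.Perm B.Path)) (hN : ∀ k ∈ K, ∀ n ∈ N, k * n * k⁻¹ ∈ N)
    (t : Equiv.Perm B.Path) : Subgroup (Equiv.Perm B.Path) where
  carrier := { k | k ∈ K ∧ k * t * k⁻¹ * t⁻¹ ∈ N }
  one_mem' := ⟨one_mem _, by simpa using one_mem N⟩
  mul_mem' := by
    rintro a b ⟨ha, ha'⟩ ⟨hb, hb'⟩
    refine ⟨mul_mem ha hb, ?_⟩
    have := mul_mem (hN a ha _ hb') ha'
    convert this using 1
    group
  inv_mem' := by
    rintro a ⟨ha, ha'⟩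
    refine ⟨inv_mem ha, ?_⟩
    have := hN _ (inv_mem ha) _ (inv_mem ha')
    convert this using 1
    group

theorem comm_swap {N : Subgroup (Equiv.Perm B.Path)} {a b : Equiv.Perm B.Path}
    (h : a * b * a⁻¹ * b⁻¹ ∈ N) : b * a * b⁻¹ * a⁻¹ ∈ N := by
  have := inv_mem h
  convert this using 1
  group

theorem trans_step {m : ℕ} {C : Set B.Path} {k : Equiv.Perm B.Path} (hk : k ∈ B.level m)
    (hkC : k ∈ fixG C) {x u : B.Path} (hv : vtx m x = vtx m u)
    (hx : ∀ d ∈ C, ¬ Agr m d x) (hu : ∀ d ∈ C, ¬ Agr m d u) :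
    ∃ k' ∈ B.level m, k' ∈ fixG C ∧ Agr m (k' x) u ∧
      ∀ x' u', Agr m (k x') u' → ¬ Agr m x' x → ¬ Agr m u' u → Agr m (k' x') u' := by
  have hv' : vtx m (k x) = vtx m u := by rw [level_vtx hk, hv]
  refine ⟨T m (k x) u * k, mul_mem (T_level _ _) hk, mul_mem (T_fixG ?_ hu) hkC, ?_, ?_⟩
  · intro d hd h
    apply hx d hd
    rw [← level_agr_iff hk, hkC.2 d hd]
    exact h
  · rw [Equiv.Perm.mul_apply]
    exact T_left hv' (Agr.refl _ _)
  · intro x' u' h1 h2 h3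
    rw [Equiv.Perm.mul_apply, T_off]
    · exact h1
    · rw [level_agr_iff hk]; exact h2
    · intro h; exact h3 (h1.symm.trans h)

theorem three_trans {m : ℕ} {C : Set B.Path} {x y z u v w : B.Path}
    (hx : ∀ d ∈ C, ¬ Agr m d x) (hy : ∀ d ∈ C, ¬ Agr m d y) (hz : ∀ d ∈ C, ¬ Agr m d z)
    (hu : ∀ d ∈ C, ¬ Agr m d u) (hv : ∀ d ∈ C, ¬ Agr m d v) (hw : ∀ d ∈ C, ¬ Agr m d w)
    (hxu : vtx m x = vtx m u) (hyv : vtx m y = vtx m v) (hzw : vtx m z = vtx m w)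
    (hxy : ¬ Agr m x y) (hxz : ¬ Agr m x z) (hyz : ¬ Agr m y z)
    (huv : ¬ Agr m u v) (huw : ¬ Agr m u w) (hvw : ¬ Agr m v w) :
    ∃ k ∈ B.level m, k ∈ fixG C ∧ Agr m (k x) u ∧ Agr m (k y) v ∧ Agr m (k z) w := by
  obtain ⟨k1, l1, c1, a1, -⟩ := trans_step (one_mem (B.level m)) (one_mem (fixG C)) hxu hx hu
  obtain ⟨k2, l2, c2, a2, b2⟩ := trans_step l1 c1 hyv hy hv
  obtain ⟨k3, l3, c3, a3, b3⟩ := trans_step l2 c2 hzw hz hw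
  exact ⟨k3, l3, c3, b3 _ _ (b2 _ _ a1 hxy huv) hxz huw, b3 _ _ a2 hyz hvw, a3⟩

theorem fix_le (heven : B.IsEven) {C : Set B.Path} (hC : C.Finite)
    (N : Subgroup (Equiv.Perm B.Path)) (hNG : N ≤ B.fullGroup)
    (hN : ∀ k ∈ fixG C, ∀ n ∈ N, k * n * k⁻¹ ∈ N) (hne : N ≠ ⊥) : fixG C ≤ N := by
  obtain ⟨h, hhN, hh1⟩ := N.bot_or_exists_ne_one.resolve_left hne
  obtain ⟨x0, hx0⟩ : ∃ x, h x ≠ x := by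
    by_contra hcon
    push Not at hcon
    exact hh1 (Equiv.ext hcon)
  obtain ⟨n, hn⟩ := hNG hhN
  obtain ⟨x1, hx10, hx1C, -⟩ := avoid heven n x0 hC
  obtain ⟨k, hk⟩ := exists_not_agr_set (x := x1) hC
  set n1 := max n k with hn1
  have hU : ∀ z, Agr n1 z x1 → ¬ Agr n1 (h z) x1 := by
    intro z hz hz'
    have e : h z = z := by
      refine Agr.eq (n := n) ((hz'.trans hz.symm).mono (le_max_left _ _)) fun i hi => ?_
      exact level_ge hn z hi
    apply hx0
    exact level_fix hn ((hx10.symm).trans (hz.mono (le_max_left _ _)).symm) e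
  have small : ∀ a ∈ fixG C, ∀ b ∈ fixG C, (∀ z, ¬ Agr n1 z x1 → a z = z) →
      (∀ z, ¬ Agr n1 z x1 → b z = z) → a * b * a⁻¹ * b⁻¹ ∈ N := by
    intro a ha b hb sa sb
    have sa' : ∀ z, ¬ Agr n1 z x1 → a⁻¹ z = z := by
      intro z hz
      rw [Equiv.Perm.inv_eq_iff_eq, sa z hz]
    have hd : h * (a⁻¹ * h⁻¹ * a⁻¹⁻¹) ∈ N := mul_mem hhN (hN _ (inv_mem ha) _ (inv_mem hhN))
    have hd2 := mul_mem hd (hN b hb _ (inv_mem hd))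
    have hdis : Equiv.Perm.Disjoint (h * a⁻¹ * h⁻¹) (a * b * a⁻¹) := by
      intro z
      by_cases hz : Agr n1 z x1
      · left
        have : ¬ Agr n1 (h⁻¹ z) x1 := by
          intro h'
          have := hU _ h'
          have e : h (h⁻¹ z) = z := by simp
          rw [e] at this
          exact this hz
        simp only [Equiv.Perm.mul_apply]
        rw [sa' _ this]
        simp
      · right
        simp only [Equiv.Perm.mul_apply]
        rw [sa' z hz, sb z hz, sa z hz]
    have hcom := hdis.commute.eq
    have e : h * (a⁻¹ * h⁻¹ * a⁻¹⁻¹) * (b * (h * (a⁻¹ * h⁻¹ * a⁻¹⁻¹))⁻¹ * b⁻¹)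
        = a * b * a⁻¹ * b⁻¹ := by
      calc _ = (h * a⁻¹ * h⁻¹) * (a * b * a⁻¹) * (h * a⁻¹ * h⁻¹)⁻¹ * b⁻¹ := by group
        _ = a * b * a⁻¹ * b⁻¹ := by rw [hcom]; group
    rw [e] at hd2
    exact hd2
  obtain ⟨m0, hm0, H3⟩ := three_cont heven n1
  have comm3 : ∀ m, m0 ≤ m → ∀ x y z : B.Path, vtx m x = vtx m y → vtx m y = vtx m z →
      (∀ d ∈ C, ¬ Agr m d x) → (∀ d ∈ C, ¬ Agr m d y) → (∀ d ∈ C, ¬ Agr m d z) →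
      ¬ Agr m x y → ¬ Agr m x z → ¬ Agr m y z →
      T m x y * T m y z * (T m x y)⁻¹ * (T m y z)⁻¹ ∈ N := by
    intro m hm x y z hxy hyz cx cy cz axy axz ayz
    obtain ⟨u, v, w, nuv, nuw, nvw, au, av, aw, tu, tv, tw⟩ := H3 x1 x
    have hCu : ∀ u, Agr n1 u x1 → ∀ d ∈ C, ¬ Agr m d u := by
      intro u hu d hd h
      exact hk n1 (le_max_right _ _) d hd (fun e => hx1C (e ▸ hd))
        ((h.mono (hm0.trans hm)).trans hu).symm
    have hvv : ∀ u : B.Path, (∀ i, m0 ≤ i → u.1 i = x.1 i) → vtx m x = vtx m u := by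
      intro u hu
      unfold vtx
      rw [hu m hm]
    have nag : ∀ u v : B.Path, (∀ i, m0 ≤ i → u.1 i = x.1 i) → (∀ i, m0 ≤ i → v.1 i = x.1 i) →
        u ≠ v → ¬ Agr m u v := by
      intro u v hu hv huv h
      exact huv (h.eq fun i hi => by rw [hu i (hm.trans hi), hv i (hm.trans hi)])
    obtain ⟨q, lq, cq, qx, qy, qz⟩ := three_trans cx cy cz (hCu u au) (hCu v av) (hCu w aw)
      (hvv u tu) (hxy.symm.trans (hvv v tv)) ((hxy.trans hyz).symm.trans (hvv w tw))
      axy axz ayz (nag u v tu tv nuv) (nag u w tu tw nuw) (nag v w tv tw nvw)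
    have supp : ∀ u v, Agr n1 u x1 → Agr n1 v x1 → ∀ z, ¬ Agr n1 z x1 → T m u v z = z := by
      intro u v hu hv z hz
      apply T_off
      · intro h; exact hz ((h.mono (hm0.trans hm)).trans hu)
      · intro h; exact hz ((h.mono (hm0.trans hm)).trans hv)
    have key := small (T m u v) (T_fixG (hCu u au) (hCu v av)) (T m v w)
      (T_fixG (hCu v av) (hCu w aw)) (supp u v au av) (supp v w av aw)
    have e1 : T m u v = q * T m x y * q⁻¹ := by
      rw [T_conj lq]; exact (T_congr qx qy).symm
    have e2 : T m v w = q * T m y z * q⁻¹ := by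
      rw [T_conj lq]; exact (T_congr qy qz).symm
    rw [e1, e2] at key
    have := hN _ (inv_mem cq) _ key
    convert this using 1
    group
  have commQ : ∀ m, m0 ≤ m → ∀ x y x' y' : B.Path, vtx m x = vtx m y → vtx m x' = vtx m y' →
      (∀ d ∈ C, ¬ Agr m d x) → (∀ d ∈ C, ¬ Agr m d y) → (∀ d ∈ C, ¬ Agr m d x') →
      (∀ d ∈ C, ¬ Agr m d y') → Agr m y x' →
      T m x y * T m x' y' * (T m x y)⁻¹ * (T m x' y')⁻¹ ∈ N := by
    intro m hm x y x' y' hv hv' cx cy cx' cy' hyx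
    have e : T m x' y' = T m y y' := T_congr hyx.symm (Agr.refl _ _)
    rw [e]
    by_cases h1 : Agr m x y
    · rw [T_self h1]; simpa using one_mem N
    by_cases h2 : Agr m y y'
    · rw [T_self h2]; simpa using one_mem N
    by_cases h3 : Agr m x y'
    · have : T m y y' = T m x y := by
        rw [T_comm x y]; exact T_congr (Agr.refl _ _) h3.symm
      rw [this]; simpa using one_mem N
    exact comm3 m hm x y y' hv (hyx.vtx.trans hv') cx cy cy' h1 h3 h2
  have commG : ∀ m, m0 ≤ m → ∀ x y x' y' : B.Path, vtx m x = vtx m y → vtx m x' = vtx m y' →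
      (∀ d ∈ C, ¬ Agr m d x) → (∀ d ∈ C, ¬ Agr m d y) → (∀ d ∈ C, ¬ Agr m d x') →
      (∀ d ∈ C, ¬ Agr m d y') →
      T m x y * T m x' y' * (T m x y)⁻¹ * (T m x' y')⁻¹ ∈ N := by
    intro m hm x y x' y' hv hv' cx cy cx' cy'
    by_cases h1 : Agr m y x'
    · exact commQ m hm x y x' y' hv hv' cx cy cx' cy' h1
    by_cases h2 : Agr m y y'
    · rw [T_comm x' y']
      exact commQ m hm x y y' x' hv hv'.symm cx cy cy' cx' h2
    by_cases h3 : Agr m x x'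
    · rw [T_comm x y]
      exact commQ m hm y x x' y' hv.symm hv' cy cx cx' cy' h3
    by_cases h4 : Agr m x y'
    · rw [T_comm x y, T_comm x' y']
      exact commQ m hm y x y' x' hv.symm hv'.symm cy cx cy' cx' h4
    rw [T_conj (T_level x y), T_off (fun h => h3 h.symm) (fun h => h1 h.symm),
      T_off (fun h => h4 h.symm) (fun h => h2 h.symm), mul_inv_cancel]
    exact one_mem N
  have commK : ∀ m, m0 ≤ m → ∀ a ∈ B.level m, (∀ x ∈ C, a x = x) → ∀ b ∈ B.level m,
      (∀ x ∈ C, b x = x) → a * b * a⁻¹ * b⁻¹ ∈ N := by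
    intro m hm a la ca b lb cb
    refine (gen_level (commSub N (fixG C) hN b) ?_ a la ca).2
    intro x y hv cx cy
    refine ⟨T_fixG cx cy, comm_swap ?_⟩
    refine (gen_level (commSub N (fixG C) hN (T m x y)) ?_ b lb cb).2
    intro x' y' hv' cx' cy'
    exact ⟨T_fixG cx' cy', commG m hm x' y' x y hv' hv cx' cy' cx cy⟩
  rintro g ⟨⟨m, hg⟩, hgC⟩
  refine gen_level N ?_ g hg hgC
  intro x y hv cx cy
  obtain ⟨a, ⟨⟨p, la⟩, ca⟩, b, ⟨⟨q, lb⟩, cb⟩, e⟩ := T_commutator heven hv cx cy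
  rw [e]
  exact commK (max m0 (max p q)) (le_max_left _ _) a (B.level_mono (by omega) la) ca b
    (B.level_mono (by omega) lb) cb

theorem fix_enlarge (heven : B.IsEven) {C : Set B.Path} (hC : C.Finite)
    (hdis : ∀ x ∈ C, ∀ y ∈ C, (∃ g ∈ B.fullGroup, g x = y) → x = y)
    (N : Subgroup (Equiv.Perm B.Path)) (hNG : N ≤ B.fullGroup) (hle : fixG C ≤ N)
    {c : B.Path} (hc : c ∈ C) {h : Equiv.Perm B.Path} (hh : h ∈ N) (hhc : h c ≠ c) :
    fixG (C \ {c}) ≤ N := by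
  have notC : ∀ g ∈ B.fullGroup, g c ≠ c → g c ∉ C := fun g hg hgc hgC =>
    hgc (hdis c hc _ hgC ⟨g, hg, rfl⟩).symm
  have hy := notC h (hNG hh) hhc
  obtain ⟨z, -, hz, g0, hg0, hg0z⟩ := avoid heven 0 c (hC.union (hC.image h))
  obtain ⟨a, ha, haz⟩ := transport (y := h c) (z := z) (D := C ∪ (h '' (C \ {c})))
    ⟨g0 * h⁻¹, mul_mem hg0 (inv_mem (hNG hh)), by simpa using hg0z⟩
    (hC.union ((hC.subset Set.sdiff_subset).image h))
    (by
      rintro (h1 | ⟨d, hd, hdc⟩)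
      · exact hy h1
      · exact hd.2 (h.injective hdc))
    (fun h1 => hz (h1.imp id fun h2 => Set.image_mono Set.sdiff_subset h2))
  have haN : a ∈ N := hle ⟨ha.1, fun x hx => ha.2 x (Or.inl hx)⟩
  have hpN : h⁻¹ * a * h ∈ N := mul_mem (mul_mem (inv_mem hh) haN) hh
  set p := h⁻¹ * a * h with hp
  have hpc : p c ≠ c := by
    intro e
    rw [hp, Equiv.Perm.mul_apply, Equiv.Perm.mul_apply, haz, Equiv.Perm.inv_eq_iff_eq] at e
    exact hz (Or.inr ⟨c, hc, e.symm⟩)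
  have hpd : ∀ d ∈ C \ {c}, p d = d := by
    intro d hd
    rw [hp, Equiv.Perm.mul_apply, Equiv.Perm.mul_apply, ha.2 (h d) (Or.inr ⟨d, hd, rfl⟩)]
    simp
  have hpC := notC p (hNG hpN) hpc
  rintro g ⟨hg, hgd⟩
  by_cases hgc : g c = c
  · refine hle ⟨hg, fun x hx => ?_⟩
    by_cases hxc : x = c
    · rw [hxc, hgc]
    · exact hgd x ⟨hx, hxc⟩
  · have hgC := notC g hg hgc
    obtain ⟨k, hk, hkk⟩ := transport (y := p c) (z := g c) (D := C)
      ⟨g * p⁻¹, mul_mem hg (inv_mem (hNG hpN)), by simp⟩ hC hpC hgC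
    have hmem : g⁻¹ * k * p ∈ N := by
      refine hle ⟨mul_mem (mul_mem (inv_mem hg) hk.1) (hNG hpN), fun x hx => ?_⟩
      rw [Equiv.Perm.mul_apply, Equiv.Perm.mul_apply, Equiv.Perm.inv_eq_iff_eq]
      by_cases hxc : x = c
      · rw [hxc, hkk]
      · rw [hpd x ⟨hx, hxc⟩, hk.2 x hx, hgd x ⟨hx, hxc⟩]
    have e : g = k * p * (g⁻¹ * k * p)⁻¹ := by group
    rw [e]
    exact mul_mem (mul_mem (hle hk) hpN) (inv_mem hmem)

theorem fix_classify (heven : B.IsEven) (N : Subgroup (Equiv.Perm B.Path))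
    (hNG : N ≤ B.fullGroup) (k : ℕ) : ∀ (C : Set B.Path), C.Finite → C.ncard = k →
    (∀ x ∈ C, ∀ y ∈ C, (∃ g ∈ B.fullGroup, g x = y) → x = y) → fixG C ≤ N →
    ∃ Z ⊆ C, N = fixG Z := by
  induction k using Nat.strong_induction_on with
  | _ k ih =>
    intro C hC hk hdis hle
    by_cases hfix : ∀ h ∈ N, ∀ c ∈ C, h c = c
    · exact ⟨C, subset_rfl, le_antisymm (fun h hh => ⟨hNG hh, hfix h hh⟩) hle⟩
    · push Not at hfix
      obtain ⟨h, hh, c, hc, hhc⟩ := hfix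
      have h1 := fix_enlarge heven hC hdis N hNG hle hc hh hhc
      obtain ⟨Z, hZ, e⟩ := ih _ (by rw [← hk]; exact Set.ncard_sdiff_singleton_lt_of_mem hc hC)
        (C \ {c}) (hC.subset Set.sdiff_subset) rfl
        (fun x hx y hy => hdis x hx.1 y hy.1) h1
      exact ⟨Z, hZ.trans Set.sdiff_subset, e⟩

theorem mem_Gcirc {A : Set B.Path} {g : ↥B.fullGroup} :
    g ∈ B.Gcirc A ↔ ∀ x ∈ A, g.1 x = x := by
  unfold Gcirc
  simp only [Subgroup.mem_iInf, MulAction.mem_stabilizer_iff]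
  rfl

end BratteliDiagram

/-- for a finite set `C = {c 1, …, c m}` whose points have pairwise disjoint
`G`-orbits, `F(C)` consists exactly of the groups `G°(Z)` for `Z ⊆ C` (including `G°(∅) = G`)
together with the trivial subgroup. -/
theorem FF_finite_set (B : BratteliDiagram)
    (hsimple : B.IsSimple) (heven : B.IsEven)
    (m : ℕ) (c : Fin m → B.Path)
    (horb : ∀ i j, i ≠ j →
      Disjoint (MulAction.orbit ↥B.fullGroup (c i)) (MulAction.orbit ↥B.fullGroup (c j))) :
    B.FF (Set.range c)
      = {H : Subgroup ↥B.fullGroup | (∃ Z ⊆ Set.range c, H = B.Gcirc Z) ∨ H = ⊥} := by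
  ext H
  simp only [Set.mem_setOf_eq]
  have conjmem : ∀ (g : ↥B.fullGroup) (K : Subgroup ↥B.fullGroup) (k : ↥B.fullGroup),
      k ∈ conjSub g K ↔ g⁻¹ * k * g ∈ K := by
    intro g K k
    unfold conjSub
    rw [Subgroup.mem_map]
    constructor
    · rintro ⟨y, hy, rfl⟩
      have : g⁻¹ * (MulAut.conj g).toMonoidHom y * g = y := by
        simp [mul_assoc]
      rw [this]; exact hy
    · intro h
      refine ⟨_, h, ?_⟩
      simp [mul_assoc]
  constructor
  · intro hH
    by_cases hbot : H = ⊥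
    · exact Or.inr hbot
    left
    have hmem : ∀ g : ↥B.fullGroup, g.1 ∈ H.map B.fullGroup.subtype ↔ g ∈ H := by
      intro g
      rw [Subgroup.mem_map]
      constructor
      · rintro ⟨y, hy, e⟩
        have : y = g := Subtype.ext e
        exact this ▸ hy
      · intro h
        exact ⟨g, h, rfl⟩
    have hNG : H.map B.fullGroup.subtype ≤ B.fullGroup := by
      rintro _ ⟨y, _, rfl⟩
      exact y.2
    have hC : (Set.range c).Finite := Set.finite_range c
    have hle := BratteliDiagram.fix_le heven hC (H.map B.fullGroup.subtype) hNG
      (by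
        rintro k ⟨hk, hkC⟩ n hn
        let k' : ↥B.fullGroup := ⟨k, hk⟩
        let n' : ↥B.fullGroup := ⟨n, hNG hn⟩
        have hn' : n' ∈ H := (hmem n').1 hn
        refine (hmem (k' * n' * k'⁻¹)).2 ?_
        rw [← hH k' (BratteliDiagram.mem_Gcirc.2 hkC), conjmem]
        have : k'⁻¹ * (k' * n' * k'⁻¹) * k' = n' := by group
        rw [this]; exact hn')
      (by
        intro e
        apply hbot
        rw [eq_bot_iff]
        intro g hg
        have := (hmem g).2 hg
        rw [e, Subgroup.mem_bot] at this
        exact Subgroup.mem_bot.2 (Subtype.ext this))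
    obtain ⟨Z, hZ, e⟩ := BratteliDiagram.fix_classify heven (H.map B.fullGroup.subtype) hNG _
      (Set.range c) hC rfl
      (by
        rintro _ ⟨i, rfl⟩ _ ⟨j, rfl⟩ ⟨g, hg, hgij⟩
        by_contra hne
        have hij : i ≠ j := fun e => hne (by rw [e])
        have hmo : c j ∈ MulAction.orbit ↥B.fullGroup (c i) := ⟨⟨g, hg⟩, hgij⟩
        exact Set.disjoint_left.1 (horb i j hij) hmo (MulAction.mem_orbit_self _)) hle
    refine ⟨Z, hZ, ?_⟩
    ext g
    rw [← hmem, e, BratteliDiagram.mem_Gcirc]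
    exact ⟨fun h => h.2, fun h => ⟨g.2, h⟩⟩
  · rintro (⟨Z, hZ, rfl⟩ | rfl)
    · intro g hg
      have hg' : g ∈ B.Gcirc Z := by
        rw [BratteliDiagram.mem_Gcirc] at hg ⊢
        exact fun x hx => hg x (hZ hx)
      ext k
      rw [conjmem]
      constructor
      · intro h
        have := mul_mem (mul_mem hg' h) (inv_mem hg')
        convert this using 1
        group
      · intro h
        exact mul_mem (mul_mem (inv_mem hg') h) hg'
    · intro g _
      unfold conjSub
      exact Subgroup.map_bot _
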